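/- Let C_0 ⊆ F_2^n have minimum weight at least 4 (n even, n > 2), and C = Span{d(E_n), e(C_0)}. Then the stabilizer of d(E_n) in Aut(C) is isomorphic to an extension 2^{dim C_0^⊥} : Aut(C_0); explicitly, it is the subgroup of the wreath product Z_2 ≀ Aut(C_0) whose sign-change part corresponds to C_0^⊥ ⊆ F_2^n. -/

import Mathlib

/-- Hamming weight of a binary word. -/
def wt {n : ℕ} (v : Fin n → ZMod 2) : ℕ :=
  (Finset.univ.filter (fun i => v i ≠ 0)).card

/-- Size of the intersection of the supports of two binary words. -/
def interCard {n : ℕ} (v w : Fin n → ZMod 2) : ℕ :=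
  (Finset.univ.filter (fun i => v i ≠ 0 ∧ w i ≠ 0)).card

/-- The doubling map `d : F₂ⁿ → F₂^{2n}`, `(c₁,…,cₙ) ↦ (c₁,c₁,c₂,c₂,…,cₙ,cₙ)`. -/
def dbl {n : ℕ} (c : Fin n → ZMod 2) : Fin (2 * n) → ZMod 2 :=
  fun i => c ⟨(i : ℕ) / 2, by have := i.isLt; omega⟩

/-- The map `e : F₂ⁿ → F₂^{2n}`, `(c₁,…,cₙ) ↦ (0,c₁,0,c₂,…,0,cₙ)`. -/
def emap {n : ℕ} (c : Fin n → ZMod 2) : Fin (2 * n) → ZMod 2 :=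
  fun i => if (i : ℕ) % 2 = 1 then c ⟨(i : ℕ) / 2, by have := i.isLt; omega⟩ else 0

/-- The even-weight code `𝓔ₙ ⊆ F₂ⁿ`. -/
def evenCode (n : ℕ) : Set (Fin n → ZMod 2) := {c | Even (wt c)}

lemma evn_lt {n : ℕ} (k : Fin n) : 2 * (k : ℕ) < 2 * n := by have := k.isLt; omega

def evn {n : ℕ} (k : Fin n) : Fin (2 * n) := ⟨2 * (k : ℕ), evn_lt k⟩

def odn {n : ℕ} (k : Fin n) : Fin (2 * n) := ⟨2 * (k : ℕ) + 1, by have := k.isLt; omega⟩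

def hlf {n : ℕ} (i : Fin (2 * n)) : Fin n := ⟨(i : ℕ) / 2, by have := i.isLt; omega⟩

def yv {n : ℕ} (v : Fin (2 * n) → ZMod 2) : Fin n → ZMod 2 := fun k => v (evn k) + v (odn k)

def sgn {n : ℕ} (σ : Equiv.Perm (Fin (2 * n))) : Fin n → ZMod 2 :=
  fun k => if ((σ (evn k) : Fin (2 * n)) : ℕ) % 2 = 1 then (1 : ZMod 2) else 0

lemma hlf_evn {n : ℕ} (k : Fin n) : hlf (evn k) = k := by
  ext; simp [hlf, evn]

lemma hlf_odn {n : ℕ} (k : Fin n) : hlf (odn k) = k := by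
  ext; simp [hlf, odn]; omega

lemma evn_or_odn {n : ℕ} (i : Fin (2 * n)) :
    (i = evn (hlf i) ∧ (i : ℕ) % 2 = 0) ∨ (i = odn (hlf i) ∧ (i : ℕ) % 2 = 1) := by
  rcases Nat.mod_two_eq_zero_or_one (i : ℕ) with h | h
  · left; refine ⟨?_, h⟩; ext; simp [hlf, evn]; omega
  · right; refine ⟨?_, h⟩; ext; simp [hlf, odn]; omega

lemma dbl_apply {n : ℕ} (c : Fin n → ZMod 2) (i : Fin (2 * n)) : dbl c i = c (hlf i) := rfl

lemma emap_apply {n : ℕ} (c : Fin n → ZMod 2) (i : Fin (2 * n)) :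
    emap c i = if (i : ℕ) % 2 = 1 then c (hlf i) else 0 := rfl

lemma emap_evn {n : ℕ} (c : Fin n → ZMod 2) (k : Fin n) : emap c (evn k) = 0 := by
  rw [emap_apply, if_neg]; simp [evn]

lemma emap_odn {n : ℕ} (c : Fin n → ZMod 2) (k : Fin n) : emap c (odn k) = c k := by
  rw [emap_apply, if_pos, hlf_odn]; simp [odn]

lemma z2 (a : ZMod 2) : a = 0 ∨ a = 1 := by revert a; decide

lemma z2_add_self (a : ZMod 2) : a + a = 0 := by revert a; decide

lemma mem_even {n : ℕ} (c : Fin n → ZMod 2) : c ∈ evenCode n ↔ ∑ k, c k = 0 := by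
  have h : ∑ k, c k = ((wt c : ℕ) : ZMod 2) := by
    unfold wt
    rw [Finset.card_filter]
    push_cast
    refine Finset.sum_congr rfl fun k _ => ?_
    rcases z2 (c k) with h | h <;> simp [h]
  rw [h, ZMod.natCast_eq_zero_iff_even]; rfl

lemma decomp {n : ℕ} (v : Fin (2 * n) → ZMod 2) :
    v = dbl (fun k => v (evn k)) + emap (yv v) := by
  ext i
  rw [Pi.add_apply, dbl_apply, emap_apply]
  rcases evn_or_odn i with ⟨h, h'⟩ | ⟨h, h'⟩
  · rw [if_neg (by omega), add_zero, ← h]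
  · rw [if_pos h', yv, ← add_assoc, z2_add_self, zero_add, ← h]

lemma mem_dbl {n : ℕ} (v : Fin (2 * n) → ZMod 2) :
    v ∈ dbl '' evenCode n ↔ yv v = 0 ∧ ∑ k, v (evn k) = 0 := by
  constructor
  · rintro ⟨c, hc, rfl⟩
    rw [mem_even] at hc
    refine ⟨?_, ?_⟩
    · ext k; simp [yv, dbl_apply, hlf_evn, hlf_odn, z2_add_self]
    · simpa [dbl_apply, hlf_evn] using hc
  · rintro ⟨h1, h2⟩
    refine ⟨fun k => v (evn k), (mem_even _).2 h2, ?_⟩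
    conv_rhs => rw [decomp v, h1]
    ext i; simp [emap_apply]

lemma mem_C {n : ℕ} (C₀ : Submodule (ZMod 2) (Fin n → ZMod 2)) (v : Fin (2 * n) → ZMod 2) :
    v ∈ Submodule.span (ZMod 2) (dbl '' evenCode n ∪ emap '' C₀) ↔
      yv v ∈ C₀ ∧ ∑ k, v (evn k) = 0 := by
  constructor
  · intro h
    induction h using Submodule.span_induction with
    | mem x hx =>
      rcases hx with hx | ⟨y, hy, rfl⟩
      · rw [mem_dbl] at hx
        exact ⟨by rw [hx.1]; exact C₀.zero_mem, hx.2⟩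
      · have : yv (emap y) = y := by ext k; simp [yv, emap_evn, emap_odn]
        exact ⟨by rw [this]; exact hy, by simp [emap_evn]⟩
    | zero =>
      have : yv (0 : Fin (2 * n) → ZMod 2) = 0 := by ext k; simp [yv]
      exact ⟨by rw [this]; exact C₀.zero_mem, by simp⟩
    | add x y _ _ hx hy =>
      have : yv (x + y) = yv x + yv y := by ext k; simp [yv]; ring
      exact ⟨by rw [this]; exact C₀.add_mem hx.1 hy.1, by
        simp [Finset.sum_add_distrib, hx.2, hy.2]⟩
    | smul a x _ hx =>
      have : yv (a • x) = a • yv x := by ext k; simp [yv]; ring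
      exact ⟨by rw [this]; exact C₀.smul_mem _ hx.1, by
        simp [← Finset.mul_sum, hx.2]⟩
  · rintro ⟨h1, h2⟩
    rw [decomp v]
    refine Submodule.add_mem _ (Submodule.subset_span (Or.inl ⟨_, (mem_even _).2 h2, rfl⟩))
      (Submodule.subset_span (Or.inr ⟨_, h1, rfl⟩))

/-- Pair-preservation in terms of `hlf`. -/
def Pres {n : ℕ} (σ : Equiv.Perm (Fin (2 * n))) (τ : Equiv.Perm (Fin n)) : Prop :=
  ∀ i, hlf (σ i) = τ (hlf i)

lemma pres_cases {n : ℕ} {σ : Equiv.Perm (Fin (2 * n))} {τ : Equiv.Perm (Fin n)}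
    (h : Pres σ τ) (k : Fin n) :
    (sgn σ k = 0 ∧ σ (evn k) = evn (τ k) ∧ σ (odn k) = odn (τ k)) ∨
    (sgn σ k = 1 ∧ σ (evn k) = odn (τ k) ∧ σ (odn k) = evn (τ k)) := by
  have h1 := h (evn k)
  have h2 := h (odn k)
  rw [hlf_evn] at h1
  rw [hlf_odn] at h2
  have hne : σ (evn k) ≠ σ (odn k) := by
    intro h
    have := σ.injective h
    simp [evn, odn] at this
  have e1 := evn_or_odn (σ (evn k))
  have e2 := evn_or_odn (σ (odn k))
  rw [h1] at e1
  rw [h2] at e2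
  rcases e1 with ⟨a, a'⟩ | ⟨a, a'⟩ <;> rcases e2 with ⟨b, b'⟩ | ⟨b, b'⟩
  · exact absurd (a.trans b.symm) hne
  · left; exact ⟨by simp [sgn, a'], a, b⟩
  · right; exact ⟨by simp [sgn, a'], a, b⟩
  · exact absurd (a.trans b.symm) hne

lemma yv_comp {n : ℕ} {σ : Equiv.Perm (Fin (2 * n))} {τ : Equiv.Perm (Fin n)}
    (h : Pres σ τ) (v : Fin (2 * n) → ZMod 2) : yv (v ∘ σ) = yv v ∘ τ := by
  ext k
  rcases pres_cases h k with ⟨_, a, b⟩ | ⟨_, a, b⟩ <;> simp [yv, a, b, add_comm]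

lemma sum_comp {n : ℕ} {σ : Equiv.Perm (Fin (2 * n))} {τ : Equiv.Perm (Fin n)}
    (h : Pres σ τ) (v : Fin (2 * n) → ZMod 2) :
    ∑ k, (v ∘ σ) (evn k) = ∑ k, v (evn k) + ∑ k, sgn σ k * (yv v ∘ τ) k := by
  rw [← Equiv.sum_comp τ (fun k => v (evn k)), ← Finset.sum_add_distrib]
  refine Finset.sum_congr rfl fun k _ => ?_
  rcases pres_cases h k with ⟨c, a, b⟩ | ⟨c, a, b⟩
  · simp [a, c]
  · simp only [Function.comp, a, c, yv, one_mul]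
    rw [← add_assoc, z2_add_self, zero_add]

lemma exists_pres {n : ℕ} (hn : 2 < n) (σ : Equiv.Perm (Fin (2 * n)))
    (h : ∀ v : Fin (2 * n) → ZMod 2, v ∈ dbl '' evenCode n → v ∘ σ ∈ dbl '' evenCode n) :
    ∃ τ, Pres σ τ := by
  have key : ∀ i j : Fin (2 * n), hlf i = hlf j → hlf (σ i) = hlf (σ j) := by
    intro i j hij
    by_contra hne
    obtain ⟨m, hm⟩ : ∃ m, m ∉ ({hlf (σ i), hlf (σ j)} : Finset (Fin n)) := by
      by_contra! hall
      have h1 : (Finset.univ : Finset (Fin n)) ⊆ {hlf (σ i), hlf (σ j)} := fun m _ => hall m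
      have h2 := Finset.card_le_card h1
      have h3 := Finset.card_le_two (a := hlf (σ i)) (b := hlf (σ j))
      simp only [Finset.card_univ, Fintype.card_fin] at h2
      omega
    simp only [Finset.mem_insert, Finset.mem_singleton, not_or] at hm
    let c : Fin n → ZMod 2 := Pi.single (hlf (σ i)) 1 + Pi.single m 1
    have hc : c ∈ evenCode n := by
      rw [mem_even]
      simp only [c, Pi.add_apply, Finset.sum_add_distrib, Finset.sum_pi_single',
        Finset.mem_univ, if_true, z2_add_self]
    obtain ⟨c', _, hc'⟩ := h _ ⟨c, hc, rfl⟩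
    have e1 := congrFun hc' i
    have e2 := congrFun hc' j
    simp only [dbl_apply, Function.comp] at e1 e2
    rw [hij, e2] at e1
    simp [c, Pi.single_apply, Ne.symm hne, Ne.symm hm.1, Ne.symm hm.2] at e1
  have hp : ∀ i, hlf (σ i) = hlf (σ (evn (hlf i))) := fun i => key _ _ (by rw [hlf_evn])
  have hs : Function.Surjective (fun k : Fin n => hlf (σ (evn k))) := by
    intro m
    refine ⟨hlf (σ.symm (evn m)), ?_⟩
    simp only
    rw [← hp, Equiv.apply_symm_apply, hlf_evn]
  exact ⟨Equiv.ofBijective _ (Finite.surjective_iff_bijective.1 hs), hp⟩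

/-- The signed permutation built from a permutation of pairs and a sign vector. -/
noncomputable def mkFun {n : ℕ} (τ : Equiv.Perm (Fin n)) (s : Fin n → ZMod 2)
    (i : Fin (2 * n)) : Fin (2 * n) :=
  if ((i : ℕ) % 2 = 1) ↔ (s (hlf i) = 0) then odn (τ (hlf i)) else evn (τ (hlf i))

lemma hlf_mkFun {n : ℕ} (τ : Equiv.Perm (Fin n)) (s : Fin n → ZMod 2)
    (i : Fin (2 * n)) : hlf (mkFun τ s i) = τ (hlf i) := by
  unfold mkFun; split_ifs <;> simp [hlf_evn, hlf_odn]

lemma mkFun_mod {n : ℕ} (τ : Equiv.Perm (Fin n)) (s : Fin n → ZMod 2)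
    (i : Fin (2 * n)) : (mkFun τ s i : ℕ) % 2 = 1 ↔ (((i : ℕ) % 2 = 1) ↔ (s (hlf i) = 0)) := by
  unfold mkFun; split_ifs with h
  · simp only [h]; simp [odn]
  · simp only [h]; simp [evn]

lemma mkFun_inj {n : ℕ} (τ : Equiv.Perm (Fin n)) (s : Fin n → ZMod 2) :
    Function.Injective (mkFun τ s) := by
  intro i j hij
  have h1 : hlf i = hlf j := τ.injective (by rw [← hlf_mkFun τ s, hij, hlf_mkFun])
  have h2 := mkFun_mod τ s i
  rw [hij, mkFun_mod, h1] at h2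
  have h3 : (i : ℕ) / 2 = (j : ℕ) / 2 := congrArg Fin.val h1
  have h4 : (i : ℕ) % 2 = 1 ↔ (j : ℕ) % 2 = 1 := by tauto
  ext; omega

noncomputable def mkPerm {n : ℕ} (τ : Equiv.Perm (Fin n)) (s : Fin n → ZMod 2) :
    Equiv.Perm (Fin (2 * n)) :=
  Equiv.ofBijective _ (Finite.injective_iff_bijective.1 (mkFun_inj τ s))

lemma mkPerm_pres {n : ℕ} (τ : Equiv.Perm (Fin n)) (s : Fin n → ZMod 2) :
    Pres (mkPerm τ s) τ := fun i => hlf_mkFun τ s i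

lemma sgn_mkPerm {n : ℕ} (τ : Equiv.Perm (Fin n)) (s : Fin n → ZMod 2) :
    sgn (mkPerm τ s) = s := by
  ext k
  have h := mkFun_mod τ s (evn k)
  rw [hlf_evn] at h
  have h0 : ¬ ((evn k : Fin (2 * n)) : ℕ) % 2 = 1 := by simp [evn]
  have h1 : ((mkPerm τ s (evn k) : Fin (2 * n)) : ℕ) % 2 = 1 ↔ ¬ s k = 0 := by
    change (mkFun τ s (evn k) : ℕ) % 2 = 1 ↔ _
    tauto
  simp only [sgn, h1]
  rcases z2 (s k) with e | e <;> simp [e]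

lemma pres_unique {n : ℕ} {σ : Equiv.Perm (Fin (2 * n))} {τ τ' : Equiv.Perm (Fin n)}
    (h : Pres σ τ) (h' : Pres σ τ') : τ = τ' := by
  ext k
  have := (h (evn k)).symm.trans (h' (evn k))
  rw [hlf_evn] at this
  rw [this]

lemma pres_ext {n : ℕ} {σ σ' : Equiv.Perm (Fin (2 * n))} {τ : Equiv.Perm (Fin n)}
    (h : Pres σ τ) (h' : Pres σ' τ) (hs : sgn σ = sgn σ') : σ = σ' := by
  have key : ∀ k, σ (evn k) = σ' (evn k) ∧ σ (odn k) = σ' (odn k) := by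
    intro k
    have hk := congrFun hs k
    rcases pres_cases h k with ⟨a, b, c⟩ | ⟨a, b, c⟩ <;>
    rcases pres_cases h' k with ⟨a', b', c'⟩ | ⟨a', b', c'⟩
    · exact ⟨b.trans b'.symm, c.trans c'.symm⟩
    · rw [a, a'] at hk; exact absurd hk (by decide)
    · rw [a, a'] at hk; exact absurd hk (by decide)
    · exact ⟨b.trans b'.symm, c.trans c'.symm⟩
  refine Equiv.ext fun i => ?_
  rcases evn_or_odn i with ⟨e, _⟩ | ⟨e, _⟩
  · rw [e]; exact (key _).1
  · rw [e]; exact (key _).2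

def dualSub {n : ℕ} (C₀ : Submodule (ZMod 2) (Fin n → ZMod 2)) :
    Submodule (ZMod 2) (Fin n → ZMod 2) where
  carrier := {x | ∀ y ∈ C₀, ∑ i, x i * y i = 0}
  add_mem' := by
    intro a b ha hb y hy
    simp [add_mul, Finset.sum_add_distrib, ha y hy, hb y hy]
  zero_mem' := by intro y _; simp
  smul_mem' := by
    intro c x hx y hy
    simp [mul_assoc, ← Finset.mul_sum, hx y hy]

def IsAut {n : ℕ} (C₀ : Submodule (ZMod 2) (Fin n → ZMod 2)) (τ : Equiv.Perm (Fin n)) : Prop :=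
  ∀ y : Fin n → ZMod 2, y ∈ C₀ ↔ y ∘ τ ∈ C₀

lemma stab_iff {n : ℕ} (hn : 2 < n) (C₀ : Submodule (ZMod 2) (Fin n → ZMod 2))
    (σ : Equiv.Perm (Fin (2 * n))) :
    ((∀ v : Fin (2 * n) → ZMod 2,
        v ∈ Submodule.span (ZMod 2) (dbl '' evenCode n ∪ emap '' C₀) ↔
        v ∘ σ ∈ Submodule.span (ZMod 2) (dbl '' evenCode n ∪ emap '' C₀)) ∧
      (∀ v : Fin (2 * n) → ZMod 2,
        v ∈ dbl '' evenCode n ↔ v ∘ σ ∈ dbl '' evenCode n)) ↔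
    ∃ τ, IsAut C₀ τ ∧ Pres σ τ ∧ sgn σ ∈ dualSub C₀ := by
  constructor
  · rintro ⟨h1, h2⟩
    obtain ⟨τ, hτ⟩ := exists_pres hn σ fun v => (h2 v).1
    have hy : ∀ y : Fin n → ZMod 2, yv (emap y) = y := by
      intro y; ext k; simp [yv, emap_evn, emap_odn]
    have h0 : ∀ y : Fin n → ZMod 2,
        y ∈ C₀ ↔ y ∘ τ ∈ C₀ ∧ ∑ k, sgn σ k * (y ∘ τ) k = 0 := by
      intro y
      have := h1 (emap y)
      rw [mem_C, mem_C, sum_comp hτ, yv_comp hτ, hy] at this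
      simpa [emap_evn] using this
    have hfwd : ∀ y ∈ C₀, y ∘ τ ∈ C₀ := fun y h => ((h0 y).1 h).1
    -- iterate to invert
    have hpow : ∀ (m : ℕ), ∀ y ∈ C₀, y ∘ ⇑(τ ^ m) ∈ C₀ := by
      intro m
      induction m with
      | zero => intro y hy; simpa using hy
      | succ m ih =>
        intro y hy
        have := hfwd _ (ih y hy)
        rw [pow_succ]
        exact this
    have hinv : ∀ y ∈ C₀, y ∘ ⇑τ.symm ∈ C₀ := by
      intro y hy
      have := hpow (orderOf τ - 1) y hy
      have e : τ ^ (orderOf τ - 1) = τ.symm := by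
        have hpos : 0 < orderOf τ := orderOf_pos τ
        refine eq_inv_of_mul_eq_one_left ?_
        rw [← pow_succ, Nat.sub_add_cancel hpos, pow_orderOf_eq_one]
      rwa [e] at this
    refine ⟨τ, fun y => ⟨hfwd y, fun h => ?_⟩, hτ, ?_⟩
    · have := hinv _ h
      rwa [Function.comp_assoc, Equiv.self_comp_symm, Function.comp_id] at this
    · intro z hz
      have := ((h0 _).1 (hinv z hz)).2
      rwa [Function.comp_assoc, Equiv.symm_comp_self, Function.comp_id] at this
  · rintro ⟨τ, ha, hp, hs⟩
    refine ⟨fun v => ?_, fun v => ?_⟩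
    · rw [mem_C, mem_C, sum_comp hp, yv_comp hp, ha (yv v)]
      refine and_congr_right fun h => ?_
      rw [hs _ h, add_zero]
    · rw [mem_dbl, mem_dbl, sum_comp hp, yv_comp hp]
      have : yv v = 0 ↔ yv v ∘ τ = 0 := by
        constructor
        · intro h; rw [h]; rfl
        · intro h; ext k
          have := congrFun h (τ.symm k)
          simpa using this
      rw [this]
      refine and_congr_right fun h => ?_
      rw [h]; simp

lemma card_wr {n : ℕ} (C₀ : Submodule (ZMod 2) (Fin n → ZMod 2)) :
    Nat.card {σ : Equiv.Perm (Fin (2 * n)) |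
      ∃ τ, IsAut C₀ τ ∧ Pres σ τ ∧ sgn σ ∈ dualSub C₀} =
    2 ^ (Module.finrank (ZMod 2) (dualSub C₀)) * Nat.card {τ | IsAut C₀ τ} := by
  have hd : Nat.card (dualSub C₀) = 2 ^ (Module.finrank (ZMod 2) (dualSub C₀)) := by
    rw [Module.natCard_eq_pow_finrank (K := ZMod 2)]; simp
  rw [← hd, ← Nat.card_prod]
  symm
  refine Nat.card_congr (Equiv.ofBijective
    (fun p => ⟨mkPerm p.2.1 p.1.1, p.2.1, p.2.2, mkPerm_pres _ _, by
      rw [sgn_mkPerm]; exact p.1.2⟩) ⟨?_, ?_⟩)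
  · rintro ⟨⟨s, hs⟩, ⟨τ, hτ⟩⟩ ⟨⟨s', hs'⟩, ⟨τ', hτ'⟩⟩ h
    have h' : mkPerm τ s = mkPerm τ' s' := congrArg Subtype.val h
    have e1 : τ = τ' := pres_unique (mkPerm_pres τ s) (by rw [h']; exact mkPerm_pres τ' s')
    have e2 : s = s' := by rw [← sgn_mkPerm τ s, h', sgn_mkPerm]
    subst e1 e2
    rfl
  · rintro ⟨σ, τ, ha, hp, hs⟩
    refine ⟨⟨⟨sgn σ, hs⟩, ⟨τ, ha⟩⟩, Subtype.ext ?_⟩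
    exact pres_ext (mkPerm_pres _ _) hp (sgn_mkPerm _ _)

/-- for `n` even, `n > 2`, and a binary code `C₀ ⊆ F₂ⁿ` of minimum weight
at least 4, the stabilizer of `d(𝓔ₙ)` in `Aut(C)` (where `C = Span{d(𝓔ₙ), e(C₀)}`) is
the extension `2^{dim C₀^⊥} : Aut(C₀)`: explicitly, it is the subgroup of the wreath
product `ℤ₂ ≀ Aut(C₀)` (pair-preserving permutations inducing an automorphism of `C₀`
on pairs) whose sign-change vector lies in `C₀^⊥`; in particular its order is
`2^{dim C₀^⊥} · |Aut(C₀)|`. -/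
theorem stabilizer_dblEven_eq (n : ℕ) (hn : 2 < n) (hne : Even n)
    (C₀ : Submodule (ZMod 2) (Fin n → ZMod 2))
    (hmin : ∀ y ∈ C₀, y ≠ 0 → 4 ≤ wt y) :
    let C : Set (Fin (2 * n) → ZMod 2) :=
      ↑(Submodule.span (ZMod 2) (dbl '' evenCode n ∪ emap '' C₀))
    let Stab : Set (Equiv.Perm (Fin (2 * n))) :=
      {σ | (∀ v : Fin (2 * n) → ZMod 2, v ∈ C ↔ v ∘ σ ∈ C) ∧
           (∀ v : Fin (2 * n) → ZMod 2,
             v ∈ dbl '' evenCode n ↔ v ∘ σ ∈ dbl '' evenCode n)}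
    let dualC₀ : Set (Fin n → ZMod 2) := {x | ∀ y ∈ C₀, ∑ i, x i * y i = 0}
    let Wr : Set (Equiv.Perm (Fin (2 * n))) :=
      {σ | ∃ τ : Equiv.Perm (Fin n),
        (∀ y : Fin n → ZMod 2, y ∈ C₀ ↔ y ∘ τ ∈ C₀) ∧
        (∀ i : Fin (2 * n),
          ((σ i : ℕ)) / 2 = ((τ ⟨(i : ℕ) / 2, by have := i.isLt; omega⟩ : Fin n) : ℕ)) ∧
        (fun k : Fin n =>
            if ((σ ⟨2 * (k : ℕ), by have := k.isLt; omega⟩ : Fin (2 * n)) : ℕ) % 2 = 1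
            then (1 : ZMod 2) else 0) ∈ dualC₀}
    Stab = Wr ∧
    Nat.card Stab =
      2 ^ (Module.finrank (ZMod 2) (Submodule.span (ZMod 2) dualC₀)) *
        Nat.card {τ : Equiv.Perm (Fin n) | ∀ y : Fin n → ZMod 2, y ∈ C₀ ↔ y ∘ τ ∈ C₀} := by
  intro C Stab dualC₀ Wr
  have hW : Wr = {σ : Equiv.Perm (Fin (2 * n)) |
      ∃ τ, IsAut C₀ τ ∧ Pres σ τ ∧ sgn σ ∈ dualSub C₀} := by
    ext σ
    refine exists_congr fun τ => and_congr_right fun _ => and_congr ?_ Iff.rfl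
    exact forall_congr' fun i => (Fin.ext_iff (a := hlf (σ i)) (b := τ (hlf i))).symm
  have hS : Stab = Wr := by
    rw [hW]
    ext σ
    exact stab_iff hn C₀ σ
  refine ⟨hS, ?_⟩
  have hspan : Submodule.span (ZMod 2) dualC₀ = dualSub C₀ := Submodule.span_eq (dualSub C₀)
  rw [hS, hW, hspan]
  exact card_wr C₀
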